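/- arXiv:2602.15914 — 5 statements merged into one kernel-verified Lean document; each statement's English description precedes it below -/
import Mathlib

section
/- Let d ≥ 1, let U be a d×d real symmetric positive definite matrix, and for a d×d real anti-symmetric matrix Q let A(Q) = (I + Q)U. Then Tr(U)/d is the greatest element of the set { min{Re λ : λ ∈ spectrum of A(Q) over ℂ} : Q anti-symmetric }; that is, for every anti-symmetric Q the minimum of the real parts of the complex eigenvalues of (I+Q)U is at most Tr(U)/d, and there exists an anti-symmetric Q for which this minimum equals Tr(U)/d. -/
open Matrix

namespace Matrix

open scoped ComplexOrder

variable {n : Type*} [Fintype n]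

lemma trace_mul_eq_zero_of_transpose_eq_neg {Q U : Matrix n n ℝ} (hQ : Qᵀ = -Q) (hU : Uᵀ = U) :
    (Q * U).trace = 0 := by
  have h : (Q * U).trace = -(Q * U).trace := by
    rw [← trace_neg, ← neg_mul, ← hQ, ← trace_transpose, transpose_mul, hU, trace_mul_comm]
  linarith

variable [DecidableEq n]

/-- Rotating two columns of `C` preserves `C * Cᵀ`; the squared norm of the first of them can be
given any value between the two original squared norms. -/
lemma exists_mul_transpose_eq_of_diag_mem_Icc (C : Matrix n n ℝ) {i j : n} (hij : i ≠ j) {t : ℝ}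
    (hi : (Cᵀ * C) i i ≤ t) (hj : t ≤ (Cᵀ * C) j j) :
    ∃ D : Matrix n n ℝ, D * Dᵀ = C * Cᵀ ∧ (Dᵀ * D) i i = t ∧
      ∀ k, k ≠ i → k ≠ j → (Dᵀ * D) k k = (Cᵀ * C) k k := by
  simp only [mul_apply, transpose_apply] at hi hj
  let f : ℝ → ℝ := fun θ ↦ ∑ a, (Real.cos θ * C a i + Real.sin θ * C a j) *
    (Real.cos θ * C a i + Real.sin θ * C a j)
  have hf : Continuous f := by fun_prop
  obtain ⟨θ, -, hθ⟩ : t ∈ f '' Set.Icc 0 (Real.pi / 2) := by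
    apply intermediate_value_Icc (by positivity) hf.continuousOn
    simpa [f] using ⟨hi, hj⟩
  refine ⟨of fun a k ↦ if k = i then Real.cos θ * C a i + Real.sin θ * C a j
    else if k = j then -Real.sin θ * C a i + Real.cos θ * C a j else C a k, ?_, ?_, ?_⟩
  · ext a b
    rw [← sub_eq_zero]
    simp only [mul_apply, transpose_apply, of_apply]
    rw [← Finset.sum_sub_distrib, Fintype.sum_eq_add i j hij]
    · simp only [if_true, hij.symm, if_false]
      linear_combination (C a i * C b i + C a j * C b j) * Real.sin_sq_add_cos_sq θ
    · rintro k ⟨hki, hkj⟩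
      simp [hki, hkj]
  · simpa [mul_apply] using hθ
  · intro k hki hkj
    simp [mul_apply, hki, hkj]

/-- Every Gram matrix `C * Cᵀ` has a factor all of whose columns have the same norm. -/
lemma exists_mul_transpose_eq_of_diag_const (C : Matrix n n ℝ) {t : ℝ}
    (ht : (C * Cᵀ).trace = Fintype.card n * t) :
    ∃ D : Matrix n n ℝ, D * Dᵀ = C * Cᵀ ∧ ∀ i, (Dᵀ * D) i i = t := by
  induction hs : (Finset.univ.filter fun i ↦ (Cᵀ * C) i i ≠ t).card using Nat.strong_induction_on
    generalizing C with
  | _ m ih =>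
  by_cases hC : ∀ i, (Cᵀ * C) i i = t
  · exact ⟨C, rfl, hC⟩
  have hsum : ∑ i, (Cᵀ * C) i i = ∑ _i : n, t := by
    rw [trace_mul_comm] at ht
    simpa [trace] using ht
  push Not at hC
  obtain ⟨i, hi⟩ : ∃ i, (Cᵀ * C) i i < t := by
    by_contra! h
    obtain ⟨k, hk⟩ := hC
    exact (Finset.sum_lt_sum (fun i _ ↦ h i)
      ⟨k, Finset.mem_univ k, lt_of_le_of_ne (h k) hk.symm⟩).ne' hsum
  obtain ⟨j, hj⟩ : ∃ j, t < (Cᵀ * C) j j := by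
    by_contra! h
    exact (Finset.sum_lt_sum (fun i _ ↦ h i) ⟨i, Finset.mem_univ i, hi⟩).ne hsum
  have hij : i ≠ j := by rintro rfl; exact lt_asymm hi hj
  obtain ⟨D, hD, hDi, hDk⟩ := exists_mul_transpose_eq_of_diag_mem_Icc C hij hi.le hj.le
  have hlt : (Finset.univ.filter fun k ↦ (Dᵀ * D) k k ≠ t).card < m := by
    rw [← hs]
    apply Finset.card_lt_card
    refine (Finset.ssubset_iff_of_subset fun k hk ↦ ?_).2 ⟨i, by simpa using hi.ne, by simpa⟩
    simp only [Finset.mem_filter, Finset.mem_univ, true_and] at hk ⊢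
    rcases eq_or_ne k i with rfl | hki
    · exact hi.ne
    rcases eq_or_ne k j with rfl | hkj
    · exact hj.ne'
    rwa [← hDk k hki hkj]
  obtain ⟨E, hE, hEt⟩ := ih _ hlt D (hD ▸ ht) rfl
  exact ⟨E, hE.trans hD, hEt⟩

/-- A Lyapunov equation with positive definite solution determines the real part of every
eigenvalue. -/
lemma re_eq_of_mem_spectrum_of_lyapunov {M P : Matrix n n ℂ} (hP : P.PosDef) {t : ℝ}
    (h : M * P + P * Mᴴ = (2 * t : ℂ) • P) {μ : ℂ} (hμ : μ ∈ spectrum ℂ M) : μ.re = t := by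
  rw [spectrum.mem_iff, isUnit_iff_isUnit_det, isUnit_iff_ne_zero, not_not,
    ← exists_vecMul_eq_zero_iff] at hμ
  obtain ⟨v, hv, hvM⟩ := hμ
  replace hvM : v ᵥ* M = μ • v := by
    rw [vecMul_sub, sub_eq_zero, Algebra.algebraMap_eq_smul_one, vecMul_smul, vecMul_one] at hvM
    exact hvM.symm
  have hq := hP.dotProduct_mulVec_pos (star_ne_zero.2 hv)
  rw [star_star] at hq
  have h1 : v ⬝ᵥ ((M * P) *ᵥ star v) = μ * (v ⬝ᵥ (P *ᵥ star v)) := by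
    rw [← mulVec_mulVec, dotProduct_mulVec, hvM, smul_dotProduct, smul_eq_mul]
  have h2 : v ⬝ᵥ ((P * Mᴴ) *ᵥ star v) = star μ * (v ⬝ᵥ (P *ᵥ star v)) := by
    rw [← mulVec_mulVec, ← star_vecMul, hvM, star_smul, mulVec_smul, dotProduct_smul, smul_eq_mul]
  have h3 := congrArg (fun X ↦ v ⬝ᵥ (X *ᵥ star v)) h
  simp only [add_mulVec, dotProduct_add, h1, h2, smul_mulVec, dotProduct_smul, smul_eq_mul] at h3
  rw [← add_mul] at h3
  have h4 := congrArg Complex.re (mul_right_cancel₀ hq.ne' h3)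
  simp at h4
  linarith

/-- The minimal real part of the eigenvalues is at most their mean. -/
lemma card_mul_sInf_re_spectrum_le_trace (A : Matrix n n ℂ) :
    Fintype.card n * sInf (Complex.re '' spectrum ℂ A) ≤ A.trace.re := by
  have hbdd : BddBelow (Complex.re '' spectrum ℂ A) := (A.finite_spectrum.image _).bddBelow
  have hcard : (A.charpoly.roots.map Complex.re).card = Fintype.card n := by
    rw [Multiset.card_map, ← (IsAlgClosed.splits A.charpoly).natDegree_eq_card_roots,
      charpoly_natDegree_eq_dim]
  have hle := Multiset.card_nsmul_le_sum (s := A.charpoly.roots.map Complex.re)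
    (a := sInf (Complex.re '' spectrum ℂ A)) fun x hx ↦ by
      obtain ⟨μ, hμ, rfl⟩ := Multiset.mem_map.1 hx
      exact csInf_le hbdd ⟨μ, mem_spectrum_iff_isRoot_charpoly.2 (Polynomial.isRoot_of_mem_roots hμ),
        rfl⟩
  rw [hcard, nsmul_eq_mul] at hle
  rw [trace_eq_sum_roots_charpoly]
  exact hle.trans_eq (map_multiset_sum Complex.reAddGroupHom _).symm

/-- For a symmetric matrix with constant diagonal `t` some antisymmetric perturbation moves all
eigenvalues to the line `re = t`. -/
lemma exists_antisymm_forall_mem_spectrum_re_eq {d : ℕ} {G : Matrix (Fin d) (Fin d) ℝ}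
    (hG : Gᵀ = G) {t : ℝ} (hdiag : ∀ i, G i i = t) :
    ∃ J : Matrix (Fin d) (Fin d) ℝ, Jᵀ = -J ∧
      ∀ μ ∈ spectrum ℂ ((G + J).map (algebraMap ℝ ℂ)), μ.re = t := by
  have hsymm : ∀ i j, G j i = G i j := fun i j ↦ congrFun₂ hG i j
  let l : Fin d → ℝ := fun i ↦ (i : ℕ) + 1
  have hl : ∀ {i j}, i ≠ j → l i - l j ≠ 0 := fun {i j} hij h ↦ hij <| Fin.ext <| by
    have : ((i : ℕ) : ℝ) = (j : ℕ) := by simp only [l] at h; linarith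
    exact_mod_cast this
  let J : Matrix (Fin d) (Fin d) ℝ := of fun i j ↦ (l i + l j) / (l i - l j) * G i j
  have hJ : Jᵀ = -J := by
    ext i j
    simp only [J, transpose_apply, neg_apply, of_apply, hsymm i j]
    rw [← neg_sub (l i) (l j), div_neg, add_comm (l j), neg_mul]
  have hreal : (G + J) * diagonal l + diagonal l * (G + J)ᵀ = (2 * t) • diagonal l := by
    rw [transpose_add, hG, hJ]
    ext i j
    simp only [add_apply, mul_diagonal, diagonal_mul, neg_apply, smul_apply, smul_eq_mul]
    rcases eq_or_ne i j with rfl | hij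
    · simp [J, hdiag]
      ring
    · rw [diagonal_apply_ne _ hij]
      have := hl hij
      simp only [J, of_apply]
      field_simp
      ring
  refine ⟨J, hJ, fun μ hμ ↦ ?_⟩
  have hP : (diagonal fun i ↦ (l i : ℂ)).PosDef :=
    posDef_diagonal_iff.2 fun i ↦ by
      have : 0 < l i := by positivity
      exact_mod_cast this
  refine re_eq_of_mem_spectrum_of_lyapunov hP ?_ hμ
  have := congrArg (fun X ↦ X.map (algebraMap ℝ ℂ)) hreal
  ext i j
  have := congrFun₂ this i j
  simp only [map_apply, add_apply, mul_diagonal, diagonal_mul, transpose_apply, smul_apply,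
    smul_eq_mul, conjTranspose_apply, diagonal_apply] at this ⊢
  rcases eq_or_ne i j with rfl | hij
  · simpa using this
  · simpa [hij] using this

end Matrix

/-- The maximal spectral gap proposition (Lelièvre et al.): for a symmetric positive
definite `U`, over all anti-symmetric `Q`, the minimum of the real parts of the complex
eigenvalues of `(I + Q) * U` is at most `Tr(U)/d`, and this bound is attained. -/
theorem stmt_0 (d : ℕ) (hd : 1 ≤ d) (U : Matrix (Fin d) (Fin d) ℝ) (hU : U.PosDef) :
    IsGreatest
      { r : ℝ | ∃ Q : Matrix (Fin d) (Fin d) ℝ, Qᵀ = -Q ∧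
          r = sInf (Complex.re ''
            spectrum ℂ (((1 + Q) * U).map (algebraMap ℝ ℂ))) }
      (U.trace / d) := by
  have hd0 : (0 : ℝ) < d := by exact_mod_cast hd
  have : Nonempty (Fin d) := ⟨⟨0, hd⟩⟩
  have hUt : Uᵀ = U := by simpa using hU.isHermitian.eq
  constructor
  · obtain ⟨C, hC⟩ : ∃ C : Matrix (Fin d) (Fin d) ℝ, U = C * Cᵀ := by
      open scoped MatrixOrder in
      obtain ⟨B, hB⟩ := CStarAlgebra.nonneg_iff_eq_star_mul_self.1 hU.posSemidef.nonneg
      exact ⟨Bᵀ, by simpa [star_eq_conjTranspose] using hB⟩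
    obtain ⟨D, hD, hDdiag⟩ := exists_mul_transpose_eq_of_diag_const C (t := U.trace / d) (by
      rw [← hC, Fintype.card_fin]
      field_simp)
    rw [← hC] at hD
    have hDunit : IsUnit D := by
      have h := hU.isUnit
      rw [← hD, isUnit_iff_isUnit_det, det_mul] at h
      exact (isUnit_iff_isUnit_det D).2 (isUnit_of_mul_isUnit_left h)
    obtain ⟨u, hu⟩ := hDunit
    set E : Matrix (Fin d) (Fin d) ℝ := ↑u⁻¹ with hE
    have hED : E * D = 1 := by rw [← hu, hE, Units.inv_mul]
    have hDE : D * E = 1 := by rw [← hu, hE, Units.mul_inv]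
    have hEDt : Eᵀ * Dᵀ = 1 := by rw [← transpose_mul, hDE, transpose_one]
    have hDEt : Dᵀ * Eᵀ = 1 := by rw [← transpose_mul, hED, transpose_one]
    obtain ⟨J, hJ, hspec⟩ := exists_antisymm_forall_mem_spectrum_re_eq
      (G := Dᵀ * D) (by simp) hDdiag
    refine ⟨Eᵀ * J * E, by simp [hJ, Matrix.mul_assoc], ?_⟩
    have hconj : (1 + Eᵀ * J * E) * U = Eᵀ * (Dᵀ * D + J) * Dᵀ := by
      rw [← hD]
      calc _ = D * Dᵀ + Eᵀ * J * (E * D) * Dᵀ := by noncomm_ring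
        _ = (Eᵀ * Dᵀ) * D * Dᵀ + Eᵀ * J * Dᵀ := by rw [hED, hEDt]; simp
        _ = _ := by noncomm_ring
    let w : (Matrix (Fin d) (Fin d) ℂ)ˣ :=
      ⟨Eᵀ.map (algebraMap ℝ ℂ), Dᵀ.map (algebraMap ℝ ℂ), by
        rw [← Matrix.map_mul, hEDt]; simp, by
        rw [← Matrix.map_mul, hDEt]; simp⟩
    have hsp : spectrum ℂ (((1 + Eᵀ * J * E) * U).map (algebraMap ℝ ℂ)) =
        spectrum ℂ ((Dᵀ * D + J).map (algebraMap ℝ ℂ)) := by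
      rw [hconj, Matrix.map_mul, Matrix.map_mul]
      exact spectrum.units_conjugate (u := w)
    have himage : Complex.re '' spectrum ℂ ((Dᵀ * D + J).map (algebraMap ℝ ℂ)) =
        {U.trace / d} := by
      refine (Set.Nonempty.image _ ?_).subset_singleton_iff.1 ?_
      · exact spectrum.nonempty_of_isAlgClosed_of_finiteDimensional ℂ _
      · rintro _ ⟨μ, hμ, rfl⟩
        exact hspec μ hμ
    rw [hsp, himage, csInf_singleton]
  · rintro _ ⟨Q, hQ, rfl⟩
    have h := card_mul_sInf_re_spectrum_le_trace (((1 + Q) * U).map (algebraMap ℝ ℂ))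
    have htr : (((1 + Q) * U).map (algebraMap ℝ ℂ)).trace.re = U.trace := by
      rw [← AddMonoidHom.map_trace, add_mul, one_mul, trace_add,
        trace_mul_eq_zero_of_transpose_eq_neg hQ hUt]
      simp
    rw [htr, Fintype.card_fin] at h
    rwa [le_div_iff₀' hd0]
end

section
/- Let d ≥ 1 and let U be a d×d real symmetric positive definite matrix. Then there exists a d×d real anti-symmetric matrix Q such that every complex eigenvalue λ of (I + Q)U satisfies Re λ = Tr(U)/d. -/
open Matrix

open scoped RealInnerProductSpace

/-- If a real-valued quadratic form `v ↦ ⟪v, T v⟫` takes values on both sides of `t` at two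
vectors, it takes the value `t` somewhere on the quarter ellipse joining them. -/
lemma exists_inner_cos_add_sin_eq {E : Type*} [NormedAddCommGroup E] [InnerProductSpace ℝ E]
    (T : E →ₗ[ℝ] E) {t : ℝ} {x y : E} (hx : ⟪x, T x⟫ ≤ t) (hy : t ≤ ⟪y, T y⟫) :
    ∃ θ : ℝ, ⟪Real.cos θ • x + Real.sin θ • y, T (Real.cos θ • x + Real.sin θ • y)⟫ = t := by
  let f : ℝ → ℝ := fun θ ↦
    ⟪Real.cos θ • x + Real.sin θ • y, T (Real.cos θ • x + Real.sin θ • y)⟫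
  have hf : Continuous f := by
    simp only [f, map_add, map_smul]
    fun_prop
  obtain ⟨θ, -, hθ⟩ := intermediate_value_Icc Real.pi_div_two_pos.le hf.continuousOn
    (show t ∈ Set.Icc (f 0) (f (Real.pi / 2)) by simpa [f] using ⟨hx, hy⟩)
  exact ⟨θ, hθ⟩

/-- An endomorphism of a Euclidean space has constant diagonal in some orthonormal basis. -/
theorem exists_orthonormalBasis_inner_eq_trace_div {ι E : Type*} [Fintype ι]
    [NormedAddCommGroup E] [InnerProductSpace ℝ E] (b₀ : OrthonormalBasis ι ℝ E)
    (T : E →ₗ[ℝ] E) :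
    ∃ b : OrthonormalBasis ι ℝ E, ∀ i, ⟪b i, T (b i)⟫ = LinearMap.trace ℝ E T / Fintype.card ι := by
  classical
  set t := LinearMap.trace ℝ E T / Fintype.card ι with ht
  have : FiniteDimensional ℝ E := b₀.toBasis.finiteDimensional_of_finite
  suffices H : ∀ s : Finset ι, ∃ b : OrthonormalBasis ι ℝ E, ∀ i ∈ s, ⟪b i, T (b i)⟫ = t by
    simpa using H Finset.univ
  intro s
  induction s using Finset.induction_on with
  | empty => exact ⟨b₀, by simp⟩
  | insert a s ha ih =>
    obtain ⟨b, hb⟩ := ih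
    have hcard : (Fintype.card ι : ℝ) ≠ 0 := by
      have : Nonempty ι := ⟨a⟩
      exact_mod_cast Fintype.card_ne_zero
    have hsum : ∑ i ∈ sᶜ, ⟪b i, T (b i)⟫ = ∑ i ∈ sᶜ, t := by
      have htr : ∑ i, ⟪b i, T (b i)⟫ = ∑ _i : ι, t := by
        rw [← LinearMap.trace_eq_sum_inner, Finset.sum_const, Finset.card_univ, nsmul_eq_mul, ht]
        field_simp
      rw [← Finset.sum_add_sum_compl s, ← Finset.sum_add_sum_compl s (fun _ ↦ t),
        Finset.sum_congr rfl hb] at htr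
      exact add_left_cancel htr
    have hne : sᶜ.Nonempty := ⟨a, by simpa using ha⟩
    obtain ⟨i, hi, hit⟩ := Finset.exists_le_of_sum_le hne hsum.le
    obtain ⟨j, hj, htj⟩ := Finset.exists_le_of_sum_le hne hsum.ge
    rw [Finset.mem_compl] at hi hj
    obtain ⟨w, hwt, hw, hws⟩ : ∃ w : E, ⟪w, T w⟫ = t ∧ ⟪w, w⟫ = 1 ∧ ∀ k ∈ s, ⟪w, b k⟫ = 0 := by
      have horth : ∀ k l, ⟪b k, b l⟫ = if k = l then 1 else 0 :=
        orthonormal_iff_ite.1 b.orthonormal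
      by_cases hij : i = j
      · subst hij
        refine ⟨b i, le_antisymm hit htj, by simp, fun k hk ↦ ?_⟩
        rw [horth, if_neg (by rintro rfl; exact hi hk)]
      · obtain ⟨θ, hθ⟩ := exists_inner_cos_add_sin_eq T hit htj
        refine ⟨_, hθ, ?_, fun k hk ↦ ?_⟩
        · simp only [inner_add_left, inner_add_right, inner_smul_left, inner_smul_right, horth,
            if_neg hij, if_neg (Ne.symm hij)]
          simp [← sq]
        · have hik : i ≠ k := by rintro rfl; exact hi hk
          have hjk : j ≠ k := by rintro rfl; exact hj hk
          simp [inner_add_left, inner_smul_left, horth, hik, hjk]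
    have hv : Orthonormal ℝ
        (((insert a s : Finset ι) : Set ι).domRestrict (Function.update b a w)) := by
      rw [orthonormal_iff_ite]
      rintro ⟨k, hk⟩ ⟨l, hl⟩
      have horth := orthonormal_iff_ite.1 b.orthonormal k l
      simp only [Finset.coe_insert, Set.mem_insert_iff, Finset.mem_coe] at hk hl
      simp only [Set.domRestrict_apply, Subtype.mk.injEq]
      by_cases hka : k = a <;> by_cases hla : l = a
      · simpa [hka, hla] using hw
      · subst hka
        simp [hla, Ne.symm hla, hws l (hl.resolve_left hla)]
      · subst hla
        simp [hka, real_inner_comm, hws k (hk.resolve_left hka)]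
      · simpa [hka, hla] using horth
    obtain ⟨b', hb'⟩ := hv.exists_orthonormalBasis_extension_of_card_eq
      (Module.finrank_eq_card_basis b.toBasis)
    refine ⟨b', fun k hk ↦ ?_⟩
    rw [hb' k (by exact_mod_cast hk)]
    by_cases hka : k = a
    · simpa [hka] using hwt
    · simpa [hka] using hb k (Finset.mem_of_mem_insert_of_ne hk hka)

namespace Matrix

/-- Every real square matrix is orthogonally similar to one with constant diagonal. -/
theorem exists_orthogonal_diag_conj_eq_trace_div {n : Type*} [Fintype n] [DecidableEq n]
    (M : Matrix n n ℝ) :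
    ∃ O : Matrix n n ℝ, Oᵀ * O = 1 ∧ ∀ i, (Oᵀ * M * O) i i = M.trace / Fintype.card n := by
  obtain ⟨b, hb⟩ := exists_orthonormalBasis_inner_eq_trace_div
    (EuclideanSpace.basisFun n ℝ) (Matrix.toEuclideanLin M)
  refine ⟨of fun i j ↦ b j i, ?_, fun i ↦ ?_⟩
  · ext i j
    have := orthonormal_iff_ite.1 b.orthonormal i j
    rw [EuclideanSpace.inner_eq_star_dotProduct] at this
    simpa [mul_apply, one_apply, dotProduct, mul_comm] using this
  · have htr : LinearMap.trace ℝ _ (Matrix.toEuclideanLin M) = M.trace := by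
      rw [toEuclideanLin_eq_toLin_orthonormal, Matrix.trace_toLin_eq]
    rw [← htr, ← hb i, EuclideanSpace.inner_eq_star_dotProduct, Matrix.mul_assoc]
    simp [mul_apply, dotProduct, mulVec, mul_comm]

/-- A symmetric positive definite matrix is `Bᵀ * B` for an invertible `B` such that `B * Bᵀ`
has constant diagonal. -/
theorem PosDef.exists_transpose_mul_self_diag_eq {n : Type*} [Fintype n] [DecidableEq n]
    {U : Matrix n n ℝ} (hU : U.PosDef) :
    ∃ B : Matrix n n ℝ, IsUnit B ∧ U = Bᵀ * B ∧
      ∀ i, (B * Bᵀ) i i = U.trace / Fintype.card n := by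
  obtain ⟨B, hB⟩ : ∃ B : Matrix n n ℝ, U = Bᵀ * B := by
    open scoped MatrixOrder in
    exact CStarAlgebra.nonneg_iff_eq_star_mul_self.mp hU.posSemidef.nonneg
  obtain ⟨O, hO, hdiag⟩ := exists_orthogonal_diag_conj_eq_trace_div (B * Bᵀ)
  have hU' : U = (Oᵀ * B)ᵀ * (Oᵀ * B) := by
    rw [transpose_mul, transpose_transpose, Matrix.mul_assoc, ← Matrix.mul_assoc O,
      mul_eq_one_comm.1 hO, Matrix.one_mul, hB]
  refine ⟨Oᵀ * B, ?_, hU', fun i ↦ ?_⟩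
  · exact isUnit_of_mul_isUnit_right (hU' ▸ hU.isUnit)
  · rw [hB, trace_mul_comm, ← hdiag i]
    simp [Matrix.mul_assoc]

/-- A symmetric matrix becomes upper triangular after adding a suitable anti-symmetric one. -/
theorem IsSymm.exists_add_isUpperTriangular {n R : Type*} [LinearOrder n] [AddCommGroup R]
    {M : Matrix n n R} (hM : M.IsSymm) :
    ∃ A : Matrix n n R, Aᵀ = -A ∧ (∀ i, A i i = 0) ∧ (M + A).IsUpperTriangular := by
  refine ⟨of fun i j ↦ if i < j then M i j else if j < i then -M i j else 0, ?_, by simp, ?_⟩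
  · ext i j
    rcases lt_trichotomy i j with h | rfl | h <;>
      simp [*, hM.apply, not_lt_of_gt]
  · intro i j (hij : j < i)
    simp [hij, not_lt_of_gt]

end Matrix

/-- Attainment half of the maximal spectral gap proposition: for symmetric positive
definite `U` there is an anti-symmetric `Q` such that every complex eigenvalue of
`(I + Q) * U` has real part exactly `Tr(U)/d`. -/
theorem stmt_2 (d : ℕ) (hd : 1 ≤ d) (U : Matrix (Fin d) (Fin d) ℝ) (hU : U.PosDef) :
    ∃ Q : Matrix (Fin d) (Fin d) ℝ, Qᵀ = -Q ∧
      ∀ lam ∈ spectrum ℂ (((1 + Q) * U).map (algebraMap ℝ ℂ)),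
        lam.re = U.trace / d := by
  obtain ⟨B, hBu, hUB, hdiag⟩ := hU.exists_transpose_mul_self_diag_eq
  obtain ⟨A, hA, hA0, htri⟩ := (isSymm_mul_transpose_self B).exists_add_isUpperTriangular
  have hdet : IsUnit B.det := (isUnit_iff_isUnit_det B).1 hBu
  have hdetT : IsUnit Bᵀ.det := by rwa [det_transpose]
  refine ⟨B⁻¹ * A * Bᵀ⁻¹, ?_, fun lam hlam ↦ ?_⟩
  · simp [transpose_mul, transpose_nonsing_inv, hA, Matrix.mul_assoc]
  · have hconj : B * ((1 + B⁻¹ * A * Bᵀ⁻¹) * Bᵀ) = B * Bᵀ + A := by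
      rw [Matrix.add_mul, Matrix.mul_add, Matrix.one_mul, nonsing_inv_mul_cancel_right _ _ hdetT,
        mul_nonsing_inv_cancel_left _ _ hdet]
    have hchar : ((1 + B⁻¹ * A * Bᵀ⁻¹) * U).charpoly =
        ∏ _i : Fin d, (Polynomial.X - Polynomial.C (U.trace / d)) := by
      rw [hUB, ← Matrix.mul_assoc, charpoly_mul_comm, hconj, charpoly_of_isUpperTriangular _ htri,
        ← hUB]
      simp [hA0, hdiag]
    rw [mem_spectrum_iff_isRoot_charpoly, charpoly_map, hchar, Polynomial.IsRoot.def] at hlam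
    simp only [Finset.prod_const, Polynomial.map_pow, Polynomial.eval_pow] at hlam
    have hlam' := eq_zero_of_pow_eq_zero hlam
    simp [sub_eq_zero] at hlam'
    simp [hlam']
end

section
/- Let d ≥ 1 and let U be a d×d real symmetric matrix. Then there exists a d×d real orthogonal matrix P such that every diagonal entry of Pᵀ U P equals Tr(U)/d. -/
open Matrix

/-- The matrix of the rotation in the plane spanned by the `i`-th and `j`-th basis vectors with
cosine `c` and sine `s`. -/
def planeRotation {n : Type*} [DecidableEq n] (i j : n) (c s : ℝ) : Matrix n n ℝ :=
  ((1 : Matrix n n ℝ).updateRow i (c • Pi.single i 1 + s • Pi.single j 1)).updateRow j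
    (-s • Pi.single i 1 + c • Pi.single j 1)

lemma conj_apply_self {n : Type*} [Fintype n] (M A : Matrix n n ℝ) (k : n) :
    (M * A * Mᵀ) k k = M k ⬝ᵥ (A *ᵥ M k) := by
  rw [Matrix.mul_assoc]
  rfl

section planeRotation

variable {n : Type*} [DecidableEq n] {i j : n} {c s : ℝ}

lemma planeRotation_row_left (hij : i ≠ j) :
    planeRotation i j c s i = c • Pi.single i 1 + s • Pi.single j 1 := by
  simp [planeRotation, updateRow_ne hij]

lemma planeRotation_row_right :
    planeRotation i j c s j = -s • Pi.single i 1 + c • Pi.single j 1 := by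
  simp [planeRotation]

lemma planeRotation_row_of_ne {k : n} (hi : k ≠ i) (hj : k ≠ j) :
    planeRotation i j c s k = Pi.single k 1 := by
  ext l
  simp [planeRotation, updateRow_ne hi, updateRow_ne hj, one_apply, Pi.single_apply, eq_comm]

variable [Fintype n]

lemma planeRotation_mul_transpose (hij : i ≠ j) (h : c ^ 2 + s ^ 2 = 1) :
    planeRotation i j c s * (planeRotation i j c s)ᵀ = 1 := by
  ext k l
  change planeRotation i j c s k ⬝ᵥ planeRotation i j c s l = _
  have row (k : n) : k = i ∨ k = j ∨ (k ≠ i ∧ k ≠ j) := by tauto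
  rcases row k with rfl | rfl | ⟨hki, hkj⟩ <;> rcases row l with rfl | rfl | ⟨hli, hlj⟩ <;>
    simp_all [planeRotation_row_left, planeRotation_row_right, planeRotation_row_of_ne,
      one_apply, Pi.single_apply, eq_comm] <;> grind

lemma planeRotation_conj_apply_left (hij : i ≠ j) (A : Matrix n n ℝ) :
    (planeRotation i j c s * A * (planeRotation i j c s)ᵀ) i i =
      c ^ 2 * A i i + c * s * (A i j + A j i) + s ^ 2 * A j j := by
  rw [conj_apply_self, planeRotation_row_left hij]
  simp [mulVec_add, mulVec_smul]
  ring

lemma planeRotation_conj_apply_of_ne (A : Matrix n n ℝ) {k : n} (hi : k ≠ i) (hj : k ≠ j) :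
    (planeRotation i j c s * A * (planeRotation i j c s)ᵀ) k k = A k k := by
  rw [conj_apply_self, planeRotation_row_of_ne hi hj]
  simp

end planeRotation

/-- A rotation of the plane can bring the quadratic form with diagonal entries `a` and `b` to any
intermediate value. -/
lemma exists_rotation_eq {a b x m : ℝ} (ha : a ≤ m) (hb : m ≤ b) :
    ∃ c s : ℝ, c ^ 2 + s ^ 2 = 1 ∧ c ^ 2 * a + c * s * x + s ^ 2 * b = m := by
  let f : ℝ → ℝ := fun t =>
    Real.cos t ^ 2 * a + Real.cos t * Real.sin t * x + Real.sin t ^ 2 * b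
  have hf : ContinuousOn f (Set.Icc 0 (Real.pi / 2)) := by fun_prop
  obtain ⟨t, -, ht⟩ := intermediate_value_Icc (by positivity) hf
    (show m ∈ Set.Icc (f 0) (f (Real.pi / 2)) by simp [f, ha, hb])
  exact ⟨Real.cos t, Real.sin t, Real.cos_sq_add_sin_sq t, ht⟩

lemma exists_diag_lt_and_gt {n : Type*} [Fintype n] {A : Matrix n n ℝ} {m : ℝ}
    (htr : A.trace = Fintype.card n * m) (h : ∃ k, A k k ≠ m) :
    ∃ i j, A i i < m ∧ m < A j j := by
  have hsum : ∑ k, (A k k - m) = 0 := by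
    simp [Finset.sum_sub_distrib, ← htr, trace]
  obtain ⟨k, hk⟩ := h
  have hk' : A k k - m ≠ 0 := sub_ne_zero.mpr hk
  obtain ⟨j, -, hj⟩ := Finset.exists_pos_of_sum_zero_of_exists_nonzero _ hsum
    ⟨k, Finset.mem_univ k, hk'⟩
  obtain ⟨i, -, hi⟩ := Finset.exists_pos_of_sum_zero_of_exists_nonzero (fun k => -(A k k - m))
    (by rw [Finset.sum_neg_distrib, hsum, neg_zero]) ⟨k, Finset.mem_univ k, neg_ne_zero.mpr hk'⟩
  exact ⟨i, j, by linarith, by linarith⟩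

/-- A real square matrix is orthogonally conjugate to one with constant diagonal. -/
lemma exists_conj_diag_eq {n : Type*} [Fintype n] [DecidableEq n] {m : ℝ} (A : Matrix n n ℝ)
    (htr : A.trace = Fintype.card n * m) :
    ∃ M : Matrix n n ℝ, M * Mᵀ = 1 ∧ ∀ k, (M * A * Mᵀ) k k = m := by
  induction hN : (Finset.univ.filter fun k => A k k ≠ m).card using Nat.strong_induction_on
    generalizing A with
  | _ N ih =>
    by_cases h : ∃ k, A k k ≠ m
    · obtain ⟨i, j, hi, hj⟩ := exists_diag_lt_and_gt htr h
      have hij : i ≠ j := by rintro rfl; exact lt_asymm hi hj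
      obtain ⟨c, s, hcs, hm⟩ := exists_rotation_eq (x := A i j + A j i) hi.le hj.le
      set R := planeRotation i j c s
      have hRR : R * Rᵀ = 1 := planeRotation_mul_transpose hij hcs
      have hRi : (R * A * Rᵀ) i i = m := (planeRotation_conj_apply_left hij A).trans hm
      have htr' : (R * A * Rᵀ).trace = Fintype.card n * m := by
        rw [trace_mul_comm, ← Matrix.mul_assoc, mul_eq_one_comm.mp hRR, Matrix.one_mul, htr]
      have hlt : (Finset.univ.filter fun k => (R * A * Rᵀ) k k ≠ m).card < N := by
        rw [← hN]
        refine Finset.card_lt_card (Finset.ssubset_iff_of_subset ?_ |>.mpr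
          ⟨i, by simpa using hi.ne, by simpa using hRi⟩)
        intro k hk
        simp only [Finset.mem_filter, Finset.mem_univ, true_and] at hk ⊢
        by_cases hki : k = i
        · exact absurd (hki ▸ hRi) hk
        by_cases hkj : k = j
        · exact hkj ▸ hj.ne'
        rwa [planeRotation_conj_apply_of_ne A hki hkj] at hk
      obtain ⟨M, hM, hMd⟩ := ih _ hlt (R * A * Rᵀ) htr' rfl
      refine ⟨M * R, ?_, fun k => ?_⟩
      · rw [transpose_mul, Matrix.mul_assoc, ← Matrix.mul_assoc R, hRR, Matrix.one_mul, hM]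
      · simpa only [transpose_mul, Matrix.mul_assoc] using hMd k
    · push Not at h
      exact ⟨1, by simp, by simpa using h⟩

/-- Equilibrated basis: for a real symmetric matrix `U` there is an orthogonal matrix `P`
such that every diagonal entry of `Pᵀ U P` equals `Tr(U)/d`. -/
theorem stmt_3 (d : ℕ) (hd : 1 ≤ d) (U : Matrix (Fin d) (Fin d) ℝ) (hU : U.IsSymm) :
    ∃ P : Matrix (Fin d) (Fin d) ℝ, Pᵀ * P = 1 ∧
      ∀ i : Fin d, (Pᵀ * U * P) i i = U.trace / d := by
  have hd' : (d : ℝ) ≠ 0 := by positivity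
  obtain ⟨M, hM, hMd⟩ := exists_conj_diag_eq (m := U.trace / d) U
    (by rw [Fintype.card_fin, mul_div_cancel₀ _ hd'])
  exact ⟨Mᵀ, by simpa using hM, by simpa using hMd⟩
end

section
/- Let d ≥ 1, let U be a d×d real symmetric matrix, let c > 0 be a real number such that U - c·I is positive semidefinite, and let Q be a d×d real anti-symmetric matrix. Then every complex eigenvalue λ of A = (I + Q)U satisfies Re λ ≥ c; in particular A is asymptotically stable (all eigenvalues have positive real part). -/
open Matrix

/-- The real part of the quadratic form of a skew-Hermitian matrix vanishes. -/
theorem re_star_dotProduct_mulVec_eq_zero {n : Type*} [Fintype n] {Q : Matrix n n ℂ}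
    (hQ : Qᴴ = -Q) (y : n → ℂ) : (star y ⬝ᵥ Q *ᵥ y).re = 0 := by
  have h : star (star y ⬝ᵥ Q *ᵥ y) = -(star y ⬝ᵥ Q *ᵥ y) := by
    rw [← star_dotProduct_star, star_star, star_mulVec, hQ,
      ← dotProduct_mulVec, neg_mulVec, dotProduct_neg]
  have h' := congrArg Complex.re h
  simp only [Complex.star_def, Complex.conj_re, Complex.neg_re] at h'
  linarith

open scoped ComplexOrder MatrixOrder Matrix.Norms.L2Operator in
/-- The entrywise complexification of a real positive semidefinite matrix is positive
semidefinite. -/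
theorem Matrix.PosSemidef.map_algebraMap_complex {n : Type*} [Fintype n] [DecidableEq n]
    {B : Matrix n n ℝ} (hB : B.PosSemidef) : (B.map (algebraMap ℝ ℂ)).PosSemidef := by
  obtain ⟨S, rfl⟩ := CStarAlgebra.nonneg_iff_eq_star_mul_self.mp hB.nonneg
  rw [Matrix.map_mul, star_eq_conjTranspose, conjTranspose_map (algebraMap ℝ ℂ) (fun r => by simp)]
  exact posSemidef_conjTranspose_mul_self _

open scoped ComplexOrder in
/-- If `B` is positive semidefinite, `c > 0` and `Q` is skew-Hermitian, then the spectrum of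
`(1 + Q) * (B + c • 1)` lies in the half-plane `c ≤ re z`. -/
theorem le_re_of_mem_spectrum_one_add_mul {n : Type*} [Fintype n] [DecidableEq n]
    {B Q : Matrix n n ℂ} {c : ℝ} (hc : 0 < c) (hB : B.PosSemidef) (hQ : Qᴴ = -Q) {z : ℂ}
    (hz : z ∈ spectrum ℂ ((1 + Q) * (B + (c : ℂ) • (1 : Matrix n n ℂ)))) : c ≤ z.re := by
  rw [← spectrum_toLin', ← Module.End.hasEigenvalue_iff_mem_spectrum] at hz
  obtain ⟨x, hx⟩ := hz.exists_hasEigenvector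
  have hx_ne := hx.2
  have h_eig := hx.apply_eq_smul
  rw [toLin'_apply, ← mulVec_mulVec, add_mulVec, one_mulVec] at h_eig
  set y := (B + (c : ℂ) • (1 : Matrix n n ℂ)) *ᵥ x with hy
  have hy' : y = B *ᵥ x + (c : ℂ) • x := by
    rw [hy, add_mulVec, smul_mulVec, one_mulVec]
  have h_sym : star (B *ᵥ x) ⬝ᵥ x = star x ⬝ᵥ B *ᵥ x := by
    rw [star_mulVec, hB.1.eq, dotProduct_mulVec]
  have hyx : star y ⬝ᵥ x = star x ⬝ᵥ B *ᵥ x + c * (star x ⬝ᵥ x) := by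
    simp [hy', h_sym]
  have hyy : star y ⬝ᵥ y = star (B *ᵥ x) ⬝ᵥ B *ᵥ x + 2 * c * (star x ⬝ᵥ B *ᵥ x)
      + c * c * (star x ⬝ᵥ x) := by
    simp only [hy', star_add, star_smul, add_dotProduct, dotProduct_add, smul_dotProduct,
      dotProduct_smul, h_sym, smul_eq_mul, Complex.star_def, Complex.conj_ofReal]
    ring
  have h := congrArg (star y ⬝ᵥ ·) h_eig
  simp only [dotProduct_add, dotProduct_smul, hyx, hyy, smul_eq_mul] at h
  obtain ⟨hb, hb'⟩ := Complex.nonneg_iff.mp (hB.dotProduct_mulVec_nonneg x)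
  obtain ⟨hm, -⟩ := Complex.nonneg_iff.mp (dotProduct_star_self_nonneg (B *ᵥ x))
  obtain ⟨hn, hn'⟩ := Complex.pos_iff.mp (dotProduct_star_self_pos_iff.mpr hx_ne)
  have hq := re_star_dotProduct_mulVec_eq_zero hQ y
  have h_re := congrArg Complex.re h
  simp [hq, hb'.symm, hn'.symm] at h_re
  generalize (star x ⬝ᵥ B *ᵥ x).re = b at *
  generalize (star x ⬝ᵥ x).re = m at *
  have h_pos : 0 < b + c * m := by positivity
  refine le_of_mul_le_mul_right ?_ h_pos
  nlinarith [mul_nonneg hc.le hb]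

/-- If `U` is symmetric with `U - c•I` positive semidefinite for some `c > 0`, and `Q` is
anti-symmetric, then every complex eigenvalue of `A = (I + Q) * U` has real part at least
`c`; in particular all eigenvalues have positive real part (asymptotic stability). -/
theorem stmt_4 (d : ℕ) (hd : 1 ≤ d) (U Q : Matrix (Fin d) (Fin d) ℝ) (c : ℝ)
    (hc : 0 < c) (hU : U.IsSymm) (hUc : (U - c • (1 : Matrix (Fin d) (Fin d) ℝ)).PosSemidef)
    (hQ : Qᵀ = -Q) :
    (∀ lam ∈ spectrum ℂ (((1 + Q) * U).map (algebraMap ℝ ℂ)), c ≤ lam.re) ∧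
      (∀ lam ∈ spectrum ℂ (((1 + Q) * U).map (algebraMap ℝ ℂ)), 0 < lam.re) := by
  have key : ∀ lam ∈ spectrum ℂ (((1 + Q) * U).map (algebraMap ℝ ℂ)), c ≤ lam.re := by
    intro lam hlam
    have hQ' : (Q.map (algebraMap ℝ ℂ))ᴴ = -Q.map (algebraMap ℝ ℂ) := by
      ext i j
      simpa using congrArg (algebraMap ℝ ℂ) (congrFun₂ hQ i j)
    refine le_re_of_mem_spectrum_one_add_mul hc hUc.map_algebraMap_complex hQ' ?_
    convert hlam using 2
    rw [Matrix.map_mul]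
    congr 1
    · ext i j
      by_cases hij : i = j <;> simp [hij]
    · ext i j
      by_cases hij : i = j <;> simp [hij]
  exact ⟨key, fun lam hlam => hc.trans_le (key lam hlam)⟩
end

section
/- Let dΛ > 0 and Λ > 0 be real numbers, and define m : ℝ → ℝ by m(t) = (1 − e^{-2 dΛ t})/dΛ − Λ e^{-2 dΛ t}. Then m is strictly increasing on ℝ, and for t ∈ ℝ one has m(t) = 0 if and only if t = ln(1 + Λ·dΛ)/(2 dΛ). In particular m has a unique zero, which is positive. -/
/-- Closed-form speciation time in the diagonalizable case: for `dΛ > 0` and `Λ > 0`, the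
function `m(t) = (1 - e^{-2 dΛ t})/dΛ - Λ e^{-2 dΛ t}` is strictly increasing, vanishes
exactly at `t_S = ln(1 + Λ dΛ)/(2 dΛ)`, and this unique zero is positive. -/
theorem stmt_11 (dL L : ℝ) (hdL : 0 < dL) (hL : 0 < L) :
    StrictMono (fun t : ℝ => (1 - Real.exp (-(2 * dL * t))) / dL - L * Real.exp (-(2 * dL * t))) ∧
    (∀ t : ℝ,
      (1 - Real.exp (-(2 * dL * t))) / dL - L * Real.exp (-(2 * dL * t)) = 0 ↔
        t = Real.log (1 + L * dL) / (2 * dL)) ∧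
    0 < Real.log (1 + L * dL) / (2 * dL) := by
  have hLd : 0 < L * dL := mul_pos hL hdL
  have hmono : StrictMono (fun t : ℝ =>
      (1 - Real.exp (-(2 * dL * t))) / dL - L * Real.exp (-(2 * dL * t))) := by
    intro s t hst
    have hexp : Real.exp (-(2 * dL * t)) < Real.exp (-(2 * dL * s)) :=
      Real.exp_lt_exp.mpr (by nlinarith)
    exact sub_lt_sub (div_lt_div_of_pos_right (by linarith) hdL)
      (mul_lt_mul_of_pos_left hexp hL)
  have hzero : (1 - Real.exp (-(2 * dL * (Real.log (1 + L * dL) / (2 * dL))))) / dL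
      - L * Real.exp (-(2 * dL * (Real.log (1 + L * dL) / (2 * dL)))) = 0 := by
    have hne : 1 + L * dL ≠ 0 := by positivity
    rw [mul_div_cancel₀ _ (by positivity), Real.exp_neg, Real.exp_log (by positivity)]
    field_simp
    ring
  refine ⟨hmono, fun t => ⟨fun ht => hmono.injective (ht.trans hzero.symm), ?_⟩,
    div_pos (Real.log_pos (by linarith)) (by positivity)⟩
  rintro rfl
  exact hzero
end
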